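/- Let G be a finite perfect group of order 1080 whose center Z has order 3 and such that G/Z is isomorphic to the alternating group A₆ (the triple cover 3.A₆, called Σ(360φ)), and let f be the character of an irreducible 3-dimensional complex representation of G. Then there exists a character λ of an irreducible 3-dimensional complex representation of G such that λ·f is an irreducible character, ⟨λ, f⁵⟩ = 1, and ⟨λ, f^n⟩ = 0 for every n with 1 ≤ n ≤ 4. -/

import Mathlib

/-- The inner product `⟨α, β⟩ = (1/|G|) · Σ_{g ∈ G} conj (α g) * β g` of class functions
(e.g. characters) on a finite group `G`. -/
noncomputable def innerChar (G : Type*) [Fintype G] (α β : G → ℂ) : ℂ :=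
  (Fintype.card G : ℂ)⁻¹ * ∑ g : G, (starRingEnd ℂ) (α g) * β g

section aut
open Cardinal Polynomial

theorem exists_algEquiv_of_card {K : Type} {L₁ L₂ : Type} [Field K] [Field L₁] [Field L₂]
    [Algebra K L₁] [Algebra K L₂] [IsAlgClosed L₁] [IsAlgClosed L₂]
    (hK : #K ≤ ℵ₀) (h1 : ℵ₀ < #L₁) (h12 : #L₁ = #L₂) :
    ∃ e : L₁ ≃+* L₂, ∀ x : K, e (algebraMap K L₁ x) = algebraMap K L₂ x := by
  obtain ⟨s, hs⟩ := exists_isTranscendenceBasis K L₁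
  obtain ⟨t, ht⟩ := exists_isTranscendenceBasis K L₂
  have hst : #s = #t := by
    rw [← IsAlgClosed.cardinal_eq_cardinal_transcendence_basis_of_aleph0_lt' _ hs hK h1,
      ← IsAlgClosed.cardinal_eq_cardinal_transcendence_basis_of_aleph0_lt' _ ht hK (h12 ▸ h1), h12]
  obtain ⟨e⟩ := Cardinal.eq.1 hst
  let _ := IsAlgClosed.isAlgClosure_of_transcendence_basis _ hs
  let _ := IsAlgClosed.isAlgClosure_of_transcendence_basis _ ht
  let e' := (hs.1.aevalEquiv.symm.trans (MvPolynomial.renameEquiv K e)).trans ht.1.aevalEquiv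
  refine ⟨IsAlgClosure.equivOfEquiv L₁ L₂ e'.toRingEquiv, fun x => ?_⟩
  rw [IsScalarTower.algebraMap_apply K (Algebra.adjoin K (Set.range ((↑) : s → L₁))) L₁,
    IsAlgClosure.equivOfEquiv_algebraMap]
  have : e'.toRingEquiv (algebraMap K _ x) = algebraMap K _ x := e'.commutes x
  rw [this, ← IsScalarTower.algebraMap_apply]

theorem exists_aut_of_hom {K : Type} [Field K] (hK : #K ≤ ℵ₀) (i j : K →+* ℂ) :
    ∃ e : ℂ ≃+* ℂ, ∀ x, e (i x) = j x := by
  have h1 : ℵ₀ < #ℂ := by rw [Cardinal.mk_complex]; exact Cardinal.aleph0_lt_continuum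
  exact @exists_algEquiv_of_card K ℂ ℂ _ _ _ i.toAlgebra j.toAlgebra _ _ hK h1 rfl

theorem exists_aut_prim (a b : ℂ) (ha : IsPrimitiveRoot a 15) (hb : IsPrimitiveRoot b 15) :
    ∃ e : ℂ ≃+* ℂ, e a = b := by
  have : Fact (Irreducible (cyclotomic 15 ℚ)) := ⟨cyclotomic.irreducible_rat (by norm_num)⟩
  have hr : ∀ c : ℂ, IsPrimitiveRoot c 15 →
      (cyclotomic 15 ℚ).eval₂ (algebraMap ℚ ℂ) c = 0 := by
    intro c hc
    have := hc.isRoot_cyclotomic (by norm_num)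
    rw [← map_cyclotomic 15 (algebraMap ℚ ℂ), IsRoot.def, eval_map] at this
    exact this
  have hK : #(AdjoinRoot (cyclotomic 15 ℚ)) ≤ ℵ₀ := by
    have hc : Countable ℚ[X] := by
      rw [← Cardinal.mk_le_aleph0_iff]
      exact (Polynomial.cardinalMk_le_max).trans (by simp)
    have : Countable (AdjoinRoot (cyclotomic 15 ℚ)) := AdjoinRoot.mk_surjective.countable
    exact Cardinal.mk_le_aleph0_iff.2 this
  obtain ⟨e, he⟩ := exists_aut_of_hom hK (AdjoinRoot.lift (algebraMap ℚ ℂ) a (hr a ha))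
    (AdjoinRoot.lift (algebraMap ℚ ℂ) b (hr b hb))
  refine ⟨e, ?_⟩
  simpa using he (AdjoinRoot.root _)

/-- the Galois automorphism we use -/
theorem exists_tau : ∃ e : ℂ ≃+* ℂ, (∀ c : ℂ, c ^ 3 = 1 → e c = c ^ 2) ∧
    (∀ t : ℂ, t ^ 2 - t - 1 = 0 → e t = 1 - t) := by
  obtain ⟨a, ha⟩ : ∃ a : ℂ, IsPrimitiveRoot a 15 :=
    ⟨_, Complex.isPrimitiveRoot_exp 15 (by norm_num)⟩
  obtain ⟨e, he⟩ := exists_aut_prim a (a ^ 2) ha (ha.pow_of_coprime 2 (by norm_num))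
  have h3 : IsPrimitiveRoot (a ^ 5) 3 := ha.pow (by norm_num) (by norm_num)
  have h5 : IsPrimitiveRoot (a ^ 3) 5 := ha.pow (by norm_num) (by norm_num)
  refine ⟨e, ?_, ?_⟩
  · intro c hc
    obtain ⟨i, -, rfl⟩ := h3.eq_pow_of_pow_eq_one hc
    simp only [map_pow, he]; ring
  · intro t ht
    set z := a ^ 3 with hz
    have hez : e z = z ^ 2 := by simp only [hz, map_pow, he]; ring
    have hz1 : z ≠ 1 := h5.ne_one (by norm_num)
    have hs : 1 + z + z ^ 2 + z ^ 3 + z ^ 4 = 0 := by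
      have h := h5.geom_sum_eq_zero (by norm_num)
      simpa [Finset.sum_range_succ] using h
    have hz5 := h5.pow_eq_one
    have hf : (t + (z ^ 2 + z ^ 3)) * (t + (z + z ^ 4)) = 0 := by
      linear_combination ht + (t + 1) * hs + (z^2+z) * hz5
    rcases mul_eq_zero.1 hf with h | h
    · have : t = -(z ^ 2 + z ^ 3) := by linear_combination h
      subst this
      simp only [map_neg, map_add, map_pow, hez]
      linear_combination -hs - z * hz5
    · have : t = -(z + z ^ 4) := by linear_combination h
      subst this
      simp only [map_neg, map_add, map_pow, hez]
      linear_combination -hs - z^3 * hz5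

end aut

section mat
open Matrix

abbrev M3 := Matrix (Fin 3) (Fin 3) ℂ

/-- second elementary symmetric function of the eigenvalues -/
def e2 (X : M3) : ℂ := X 0 0 * X 1 1 - X 0 1 * X 1 0 + X 0 0 * X 2 2 - X 0 2 * X 2 0
  + X 1 1 * X 2 2 - X 1 2 * X 2 1

theorem ch3 (X : M3) (hd : X.det = 1) : X * X * X = X.trace • (X * X) - e2 X • X + 1 := by
  rw [det_fin_three] at hd
  ext i j
  fin_cases i <;> fin_cases j <;>
    simp [Matrix.mul_apply, Fin.sum_univ_three, trace_fin_three, e2] <;>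
    first | ring1 | linear_combination hd

theorem tr_sq (X : M3) : (X * X).trace = X.trace ^ 2 - 2 * e2 X := by
  simp [Matrix.mul_apply, Fin.sum_univ_three, trace_fin_three, e2]; ring

theorem tr_one3 : (1 : M3).trace = 3 := by simp

theorem tr_inv (X Y : M3) (hd : X.det = 1) (h : X * Y = 1) : Y.trace = e2 X := by
  have h1 : X * X = X.trace • X - e2 X • 1 + Y := by
    have := congrArg (· * Y) (ch3 X hd)
    simpa [add_mul, sub_mul, mul_assoc, h] using this
  have h2 := congrArg Matrix.trace h1
  rw [tr_sq] at h2
  simp only [trace_add, trace_sub, trace_smul, tr_one3, smul_eq_mul] at h2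
  linear_combination -h2

theorem tr_five (X Y : M3) (hd : X.det = 1) (h : X * Y = 1) (ht : Y.trace = X.trace)
    (h5 : X ^ 5 = 1) : X.trace = 3 ∨ X.trace ^ 2 - X.trace - 1 = 0 := by
  have he : e2 X = X.trace := by rw [← ht, tr_inv X Y hd h]
  have h3 := ch3 X hd
  rw [he] at h3
  have q2 := tr_sq X
  rw [he] at q2
  have q3 := congrArg Matrix.trace h3
  have h4 : X * X * X * X = X.trace • (X * X * X) - X.trace • (X * X) + X := by
    conv_lhs => rw [h3]
    simp [add_mul, sub_mul]
  have q4 := congrArg Matrix.trace h4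
  have h5' : X * X * X * X * X = X.trace • (X * X * X * X) - X.trace • (X * X * X) + X * X := by
    conv_lhs => rw [h4]
    simp [add_mul, sub_mul]
  have q5 := congrArg Matrix.trace h5'
  have : X * X * X * X * X = 1 := by rw [← h5]; simp only [pow_succ, pow_zero, one_mul]
  rw [this] at q5
  simp only [trace_add, trace_sub, trace_smul, tr_one3, smul_eq_mul] at q2 q3 q4 q5
  rw [q4, q3, q2] at q5
  generalize X.trace = t at *
  have : (t - 3) * (t ^ 2 - t - 1) ^ 2 = 0 := by linear_combination -q5
  rcases mul_eq_zero.1 this with h | h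
  · left; linear_combination h
  · right; exact pow_eq_zero_iff (by norm_num) |>.1 h

theorem eq_one_of_tr (X : M3) (hd : X.det = 1) (ht : X.trace = 3) (he : e2 X = 3) (n : ℕ)
    (hn : n ≠ 0) (h : X ^ n = 1) : X = 1 := by
  obtain ⟨N, rfl⟩ : ∃ N, X = 1 + N := ⟨X - 1, by abel⟩
  have h3 := ch3 _ hd
  rw [ht, he] at h3
  have hN : N * N * N = 0 := by
    have : (1 + N) * (1 + N) * (1 + N) - ((3:ℂ) • ((1 + N) * (1 + N)) - (3:ℂ) • (1 + N) + 1)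
      = N * N * N := by
      simp only [add_mul, mul_add, one_mul, mul_one, smul_add]
      module
    rw [← this, h3, sub_self]
  have hp : ∀ m : ℕ, ∃ c : ℂ, (1 + N) ^ m = 1 + (m : ℂ) • N + c • (N * N) := by
    intro m
    induction m with
    | zero => exact ⟨0, by simp⟩
    | succ m ih =>
      obtain ⟨c, hc⟩ := ih
      refine ⟨c + m, ?_⟩
      rw [pow_succ, hc]
      simp only [add_mul, mul_add, one_mul, mul_one, smul_mul_assoc, hN]
      push_cast
      module
  obtain ⟨c, hc⟩ := hp n
  rw [h] at hc
  have h0 : (n : ℂ) • N + c • (N * N) = 0 := by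
    have := hc.symm
    rwa [add_assoc, add_eq_left] at this
  have hn' : (n : ℂ) ≠ 0 := by exact_mod_cast hn
  have h1 : N * N = 0 := by
    have := congrArg (· * N) h0
    simp only [add_mul, smul_mul_assoc, hN, smul_zero, add_zero, zero_mul] at this
    exact (smul_eq_zero.1 this).resolve_left hn'
  rw [h1, smul_zero, add_zero] at h0
  rw [(smul_eq_zero.1 h0).resolve_left hn', add_zero]

theorem eig_pow (X : M3) (n : ℕ) (h : X ^ n = 1) (a : ℂ)
    (hdet : (a • (1 : M3) - X).det = 0) : a ^ n = 1 := by
  obtain ⟨v, hv, hv'⟩ := Matrix.exists_mulVec_eq_zero_iff.2 hdet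
  have hX : X *ᵥ v = a • v := by
    rw [sub_mulVec, smul_mulVec, one_mulVec, sub_eq_zero] at hv'
    exact hv'.symm
  have hp : ∀ m : ℕ, (X ^ m) *ᵥ v = a ^ m • v := by
    intro m
    induction m with
    | zero => simp
    | succ m ih => rw [pow_succ, ← mulVec_mulVec, hX, mulVec_smul, ih, smul_smul, pow_succ, mul_comm]
  have := hp n
  rw [h, one_mulVec] at this
  have h2 : (a ^ n - 1) • v = 0 := by rw [sub_smul, one_smul, ← this, sub_self]
  exact sub_eq_zero.1 ((smul_eq_zero.1 h2).resolve_right hv)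

theorem det_char (X : M3) (hd : X.det = 1) (a : ℂ) :
    (a • (1 : M3) - X).det = a ^ 3 - X.trace * a ^ 2 + e2 X * a - 1 := by
  rw [← hd]
  simp [det_fin_three, trace_fin_three, e2]
  ring

theorem conj_of_pow {a : ℂ} {n : ℕ} (hn : n ≠ 0) (h : a ^ n = 1) :
    a * (starRingEnd ℂ) a = 1 := by
  rw [Complex.mul_conj, Complex.normSq_eq_norm_sq, Complex.norm_eq_one_of_pow_eq_one h hn]
  simp

theorem tr_conj (X Y : M3) (hd : X.det = 1) (n : ℕ) (hn : n ≠ 0) (h : X ^ n = 1)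
    (hXY : X * Y = 1) : Y.trace = (starRingEnd ℂ) X.trace := by
  rw [tr_inv X Y hd hXY]
  have hc := det_char X hd
  have hpw := eig_pow X n h
  generalize X.trace = t at *
  generalize e2 X = s at *
  obtain ⟨a, ha⟩ : ∃ a : ℂ, a ^ 3 - t * a ^ 2 + s * a - 1 = 0 := by
    obtain ⟨a, ha⟩ := IsAlgClosed.exists_root
      (Polynomial.X ^ 3 - Polynomial.C t * Polynomial.X ^ 2 + Polynomial.C s * Polynomial.X
        - Polynomial.C 1) (by
        have : (Polynomial.X ^ 3 - Polynomial.C t * Polynomial.X ^ 2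
          + Polynomial.C s * Polynomial.X - Polynomial.C 1).degree = 3 := by
          compute_degree!
        rw [this]; norm_num)
    exact ⟨a, by simpa [Polynomial.IsRoot.def] using ha⟩
  obtain ⟨b, hb⟩ : ∃ b : ℂ, b ^ 2 + (a - t) * b + (a ^ 2 - t * a + s) = 0 := by
    obtain ⟨r, hr⟩ := IsAlgClosed.exists_eq_mul_self
      (discrim 1 (a - t) (a ^ 2 - t * a + s))
    obtain ⟨b, hb⟩ := exists_quadratic_eq_zero one_ne_zero ⟨r, hr⟩
    exact ⟨b, by linear_combination hb⟩
  obtain ⟨c, hcc⟩ : ∃ c, c = t - a - b := ⟨_, rfl⟩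
  have ht : t = a + b + c := by rw [hcc]; ring
  subst ht
  have hs : s = a * b + b * c + a * c := by linear_combination hb
  subst hs
  have h1 : a * b * c = 1 := by linear_combination ha
  have Ha := conj_of_pow hn (hpw a (by rw [hc]; linear_combination h1))
  have Hb := conj_of_pow hn (hpw b (by rw [hc]; linear_combination h1))
  have Hc := conj_of_pow hn (hpw c (by rw [hc]; linear_combination h1))
  simp only [map_add]
  linear_combination (-b * c) * Ha - a * c * Hb - a * b * Hc + ((starRingEnd ℂ) a + (starRingEnd ℂ) b + (starRingEnd ℂ) c) * h1

end mat

abbrev A6 := alternatingGroup (Fin 6)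

set_option maxRecDepth 100000 in
theorem a6_c2 : (Finset.univ.filter (fun q : A6 => q ^ 2 = 1 ∧ q ≠ 1)).card = 45 := by
  decide +kernel

set_option maxRecDepth 100000 in
theorem a6_c4 : (Finset.univ.filter (fun q : A6 => q ^ 4 = 1 ∧ q ^ 2 ≠ 1)).card = 90 := by
  decide +kernel

set_option maxRecDepth 100000 in
theorem a6_c5 : (Finset.univ.filter (fun q : A6 => q ^ 5 = 1 ∧ q ≠ 1)).card = 144 := by
  decide +kernel

set_option maxRecDepth 100000 in
theorem a6_cases : ∀ q : A6,
    (q = 1 ∨ q ^ 2 = 1 ∨ q ^ 4 = 1 ∨ q ^ 5 = 1 ∨ q ^ 3 = 1) := by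
  decide +kernel

set_option maxRecDepth 100000 in
theorem a6_real : ∀ q : A6, (q ^ 4 = 1 ∨ q ^ 5 = 1) → ∃ r : A6, r * q = q⁻¹ * r := by
  decide +kernel

theorem a6_sum (h : A6 → ℂ) (A B C D : ℂ) (h1 : h 1 = A)
    (h2 : ∀ q, q ^ 2 = 1 → q ≠ 1 → h q = B) (h4 : ∀ q, q ^ 4 = 1 → q ^ 2 ≠ 1 → h q = C)
    (h5 : ∀ q, q ^ 5 = 1 → q ≠ 1 → h q + h (q ^ 2) = D) :
    ∑ q, h q = A + 45 * B + 90 * C + 72 * D +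
      ∑ q ∈ Finset.univ.filter (fun q : A6 => q ^ 3 = 1 ∧ q ≠ 1), h q := by
  have key : ∀ q : A6, h q = (if q = 1 then h q else 0) + (if q ^ 2 = 1 ∧ q ≠ 1 then h q else 0)
      + (if q ^ 4 = 1 ∧ q ^ 2 ≠ 1 then h q else 0) + (if q ^ 5 = 1 ∧ q ≠ 1 then h q else 0)
      + (if q ^ 3 = 1 ∧ q ≠ 1 then h q else 0) := by
    intro q
    by_cases e1 : q = 1
    · subst e1; simp
    have cop : ∀ m n : ℕ, Nat.Coprime m n → q ^ m = 1 → q ^ n ≠ 1 := by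
      intro m n hc hm hn
      have hd := Nat.dvd_gcd (orderOf_dvd_of_pow_eq_one hm) (orderOf_dvd_of_pow_eq_one hn)
      rw [hc.gcd_eq_one, Nat.dvd_one, orderOf_eq_one_iff] at hd
      exact e1 hd
    by_cases e2 : q ^ 2 = 1
    · have e3 := cop 2 3 (by norm_num) e2
      have e5 := cop 2 5 (by norm_num) e2
      simp [e1, e2, e3, e5]
    by_cases e4 : q ^ 4 = 1
    · have e3 := cop 4 3 (by norm_num) e4
      have e5 := cop 4 5 (by norm_num) e4
      simp [e1, e2, e3, e5, e4]
    by_cases e5 : q ^ 5 = 1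
    · have e3 := cop 5 3 (by norm_num) e5
      simp [e1, e2, e3, e5, e4]
    have e3 : q ^ 3 = 1 := by
      have := a6_cases q; tauto
    simp [e1, e2, e3, e5, e4]
  have s1 : ∑ q ∈ Finset.univ.filter (fun q : A6 => q = 1), h q = A := by
    rw [Finset.filter_eq', if_pos (Finset.mem_univ _), Finset.sum_singleton, h1]
  have s2 : ∑ q ∈ Finset.univ.filter (fun q : A6 => q ^ 2 = 1 ∧ q ≠ 1), h q = 45 * B := by
    rw [Finset.sum_congr rfl (g := fun _ => B)]
    · rw [Finset.sum_const, a6_c2]; simp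
    · intro q hq; simp only [Finset.mem_filter] at hq; exact h2 q hq.2.1 hq.2.2
  have s4 : ∑ q ∈ Finset.univ.filter (fun q : A6 => q ^ 4 = 1 ∧ q ^ 2 ≠ 1), h q = 90 * C := by
    rw [Finset.sum_congr rfl (g := fun _ => C)]
    · rw [Finset.sum_const, a6_c4]; simp
    · intro q hq; simp only [Finset.mem_filter] at hq; exact h4 q hq.2.1 hq.2.2
  have s5 : ∑ q ∈ Finset.univ.filter (fun q : A6 => q ^ 5 = 1 ∧ q ≠ 1), h q = 72 * D := by
    have p5 : ∑ q ∈ Finset.univ.filter (fun q : A6 => q ^ 5 = 1 ∧ q ≠ 1), h q =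
        ∑ q ∈ Finset.univ.filter (fun q : A6 => q ^ 5 = 1 ∧ q ≠ 1), h (q ^ 2) := by
      have p6 : ∀ q : A6, q ^ 5 = 1 → q ^ 6 = q := fun q hq => by
        rw [pow_succ, hq, one_mul]
      symm
      refine Finset.sum_nbij' (fun q => q ^ 2) (fun q => q ^ 3) ?_ ?_ ?_ ?_ ?_
      · intro q hq
        simp only [Finset.mem_filter, Finset.mem_univ, true_and] at hq ⊢
        refine ⟨by rw [← pow_mul, mul_comm, pow_mul, hq.1, one_pow], fun h0 => hq.2 ?_⟩
        rw [← p6 q hq.1, pow_mul q 2 3, h0, one_pow]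
      · intro q hq
        simp only [Finset.mem_filter, Finset.mem_univ, true_and] at hq ⊢
        refine ⟨by rw [← pow_mul, mul_comm, pow_mul, hq.1, one_pow], fun h0 => hq.2 ?_⟩
        rw [← p6 q hq.1, pow_mul q 3 2, h0, one_pow]
      · intro q hq
        simp only [Finset.mem_filter, Finset.mem_univ, true_and] at hq ⊢
        rw [← pow_mul]; exact p6 q hq.1
      · intro q hq
        simp only [Finset.mem_filter, Finset.mem_univ, true_and] at hq ⊢
        rw [← pow_mul]; exact p6 q hq.1
      · intro q hq; rfl
    have : ∑ q ∈ Finset.univ.filter (fun q : A6 => q ^ 5 = 1 ∧ q ≠ 1), (h q + h (q ^ 2))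
        = 144 * D := by
      rw [Finset.sum_congr rfl (g := fun _ => D)]
      · rw [Finset.sum_const, a6_c5]; simp
      · intro q hq; simp only [Finset.mem_filter] at hq; exact h5 q hq.2.1 hq.2.2
    rw [Finset.sum_add_distrib, ← p5] at this
    linear_combination this / 2
  rw [Finset.sum_congr rfl (fun q _ => key q)]
  simp only [Finset.sum_add_distrib]
  rw [← Finset.sum_filter, ← Finset.sum_filter, ← Finset.sum_filter, ← Finset.sum_filter,
    ← Finset.sum_filter, s2, s4, s5, s1]

section core
set_option linter.unusedSectionVars false
theorem conj_three : (starRingEnd ℂ) 3 = 3 := map_ofNat _ 3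

variable {G : Type*} [Group G] [Fintype G] (π : G →* A6) (hsurj : Function.Surjective π)
  (hker : ∀ g, π g = 1 ↔ g ∈ Subgroup.center G)
  (hz3 : ∀ z ∈ Subgroup.center G, z ^ 3 = 1)

include hker hz3 in
theorem pow21 {g g' : G} (h : π g = π g') : g ^ 21 = g' ^ 21 := by
  have hz : g'⁻¹ * g ∈ Subgroup.center G := by
    rw [← hker, map_mul, map_inv, h, inv_mul_cancel]
  have hg : g = g' * (g'⁻¹ * g) := by group
  have hc : Commute g' (g'⁻¹ * g) := (Subgroup.mem_center_iff.1 hz g')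
  rw [hg, hc.mul_pow, pow_mul (g'⁻¹ * g) 3 7, hz3 _ hz, one_pow, mul_one]

include hker hz3 in
theorem pow21_one {g : G} (h : π g = 1) : g ^ 21 = 1 := by
  rw [pow21 π hker hz3 (g' := 1) (by rw [h, map_one]), one_pow]

theorem pi21 {g : G} (n m : ℕ) (hnm : n * m = 20) (h : π g ^ n = 1) : π (g ^ 21) = π g := by
  rw [map_pow, pow_succ, ← hnm, pow_mul, h, one_pow, one_mul]

include hsurj hker in
theorem group_sum_section (hzc : Nat.card (Subgroup.center G) = 3) (H : G → ℂ)
    (hH : ∀ g, ∀ z ∈ Subgroup.center G, H (g * z) = H g) :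
    ∑ g, H g = 3 * ∑ q, H (Function.surjInv hsurj q) := by
  classical
  have hl : ∀ q, π (Function.surjInv hsurj q) = q := Function.surjInv_eq hsurj
  have : Fintype (Subgroup.center G) := Fintype.ofFinite _
  rw [← Fintype.sum_bijective (fun p : A6 × Subgroup.center G =>
    Function.surjInv hsurj p.1 * p.2) ?_ (fun p => H (Function.surjInv hsurj p.1)) H ?_]
  · rw [Fintype.sum_prod_type, Finset.mul_sum]
    simp only [Finset.sum_const, Finset.card_univ, ← Nat.card_eq_fintype_card, hzc]
    simp
  · constructor
    · rintro ⟨q, z⟩ ⟨q', z'⟩ h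
      simp only at h
      have h1 := congrArg π h
      rw [map_mul, map_mul, (hker _).2 z.2, (hker _).2 z'.2, hl, hl, mul_one, mul_one] at h1
      subst h1
      simpa using h
    · intro g
      refine ⟨(π g, ⟨(Function.surjInv hsurj (π g))⁻¹ * g, ?_⟩), by simp⟩
      rw [← hker, map_mul, map_inv, hl, inv_mul_cancel]
  · rintro ⟨q, z⟩
    exact (hH _ _ z.2).symm

include hsurj hker hz3 in
theorem group_sum (hzc : Nat.card (Subgroup.center G) = 3) (H : G → ℂ)
    (hH : ∀ g, ∀ z ∈ Subgroup.center G, H (g * z) = H g) (A B C D : ℂ) (h1 : H 1 = A)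
    (h2 : ∀ g, π g ^ 2 = 1 → π g ≠ 1 → H (g ^ 21) = B)
    (h4 : ∀ g, π g ^ 4 = 1 → π g ^ 2 ≠ 1 → H (g ^ 21) = C)
    (h5 : ∀ g, π g ^ 5 = 1 → π g ≠ 1 → H (g ^ 21) + H ((g ^ 2) ^ 21) = D) :
    ∑ g, H g = 3 * (A + 45 * B + 90 * C + 72 * D +
      ∑ q ∈ Finset.univ.filter (fun q : A6 => q ^ 3 = 1 ∧ q ≠ 1), H (Function.surjInv hsurj q)) := by
  have hl : ∀ q, π (Function.surjInv hsurj q) = q := Function.surjInv_eq hsurj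
  have inv : ∀ g g', π g = π g' → H g = H g' := by
    intro g g' h
    have hz : g'⁻¹ * g ∈ Subgroup.center G := by
      rw [← hker, map_mul, map_inv, h, inv_mul_cancel]
    rw [← hH g' _ hz]; congr 1; group
  rw [group_sum_section π hsurj hker hzc H hH, a6_sum (fun q => H (Function.surjInv hsurj q))
    A B C D]
  · rw [← h1]; apply inv; rw [hl, map_one]
  · intro q hq hq'
    rw [← h2 (Function.surjInv hsurj q) (by rw [hl, hq]) (by rwa [hl])]
    exact inv _ _ (pi21 π 2 10 (by norm_num) (by rw [hl, hq])).symm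
  · intro q hq hq'
    rw [← h4 (Function.surjInv hsurj q) (by rw [hl, hq]) (by rwa [hl])]
    exact inv _ _ (pi21 π 4 5 (by norm_num) (by rw [hl, hq])).symm
  · intro q hq hq'
    have hq2 : (q ^ 2) ^ 5 = 1 := by rw [← pow_mul, mul_comm, pow_mul, hq, one_pow]
    rw [← h5 (Function.surjInv hsurj q) (by rw [hl, hq]) (by rwa [hl])]
    congr 1
    · exact inv _ _ (pi21 π 5 4 (by norm_num) (by rw [hl, hq])).symm
    · apply inv
      rw [pi21 π 5 4 (by norm_num) (by rw [map_pow, hl, hq2]), map_pow, hl, hl]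

variable (R : G →* M3) (hdet : ∀ g, (R g).det = 1) (hfaith : ∀ g, R g = 1 → π g = 1)

include hdet hfaith in
theorem tr_ne_three {x : G} {n : ℕ} (hn : n ≠ 0) (hx : x ^ n = 1) (hπ : π x ≠ 1)
    (hr : (R x⁻¹).trace = (R x).trace) : (R x).trace ≠ 3 := by
  intro h3
  apply hπ; apply hfaith
  refine eq_one_of_tr _ (hdet x) h3 ?_ n hn (by rw [← map_pow, hx, map_one])
  rw [← tr_inv (R x) (R x⁻¹) (hdet x) (by rw [← map_mul, mul_inv_cancel, map_one]), hr, h3]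

include hdet in
theorem tr_sq_real {x : G} (hr : (R x⁻¹).trace = (R x).trace) :
    (R (x ^ 2)).trace = (R x).trace ^ 2 - 2 * (R x).trace := by
  rw [pow_two, map_mul, tr_sq,
    ← tr_inv (R x) (R x⁻¹) (hdet x) (by rw [← map_mul, mul_inv_cancel, map_one]), hr]

include hdet hfaith hker hz3 in
theorem val2 (g : G) (h : π g ^ 2 = 1) (h' : π g ≠ 1) : (R (g ^ 21)).trace = -1 := by
  have hπ := pi21 π 2 10 (by norm_num) h
  have hx : (g ^ 21) ^ 2 = 1 := by
    rw [← pow_mul, mul_comm, pow_mul]; exact pow21_one π hker hz3 (by rw [map_pow, h])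
  rw [← hπ] at h'
  generalize g ^ 21 = x at *
  have hxi : x⁻¹ = x := by rw [pow_two] at hx; exact inv_eq_of_mul_eq_one_left hx
  have hr : (R x⁻¹).trace = (R x).trace := by rw [hxi]
  have h3 := tr_ne_three π R hdet hfaith two_ne_zero hx h' hr
  have hs := tr_sq_real R hdet hr
  rw [hx, map_one, tr_one3] at hs
  have : ((R x).trace - 3) * ((R x).trace + 1) = 0 := by linear_combination -hs
  rcases mul_eq_zero.1 this with h | h
  · exact absurd (by linear_combination h) h3
  · linear_combination h

include hsurj hker hz3 in
theorem real21 (g : G) (h : π g ^ 4 = 1 ∨ π g ^ 5 = 1) :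
    (R (g ^ 21)⁻¹).trace = (R (g ^ 21)).trace := by
  obtain ⟨r, hr⟩ := a6_real (π g) h
  obtain ⟨k, rfl⟩ := hsurj r
  have h1 : π (k * g * k⁻¹) = π g⁻¹ := by
    rw [map_mul, map_mul, map_inv, map_inv, hr]; group
  have h2 := pow21 π hker hz3 h1
  rw [conj_pow, inv_pow] at h2
  rw [← h2, map_mul, Matrix.trace_mul_comm, ← map_mul]
  congr 2; group

include hsurj hdet hfaith hker hz3 in
theorem val4 (g : G) (h : π g ^ 4 = 1) (h' : π g ^ 2 ≠ 1) : (R (g ^ 21)).trace = 1 := by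
  have hr := real21 π hsurj hker hz3 R g (Or.inl h)
  have hs := tr_sq_real R hdet hr
  rw [← pow_mul, mul_comm, pow_mul, val2 π hker hz3 R hdet hfaith (g ^ 2)
    (by rw [map_pow, ← pow_mul]; exact h) (by rwa [map_pow])] at hs
  have : ((R (g ^ 21)).trace - 1) ^ 2 = 0 := by linear_combination -hs
  have := pow_eq_zero_iff (two_ne_zero) |>.1 this
  linear_combination this

include hsurj hdet hfaith hker hz3 in
theorem val5 (g : G) (h : π g ^ 5 = 1) (h' : π g ≠ 1) :
    ∃ t : ℂ, t ^ 2 - t - 1 = 0 ∧ (R (g ^ 21)).trace = t ∧ (R ((g ^ 2) ^ 21)).trace = 1 - t := by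
  have hr := real21 π hsurj hker hz3 R g (Or.inr h)
  have hπ := pi21 π 5 4 (by norm_num) h
  have hx : (g ^ 21) ^ 5 = 1 := by
    rw [← pow_mul, mul_comm, pow_mul]; exact pow21_one π hker hz3 (by rw [map_pow, h])
  have hs := tr_sq_real R hdet hr
  rw [← hπ] at h'
  have h3 := tr_ne_three π R hdet hfaith (by norm_num) hx h' hr
  have := (tr_five (R (g ^ 21)) (R (g ^ 21)⁻¹) (hdet _)
    (by rw [← map_mul, mul_inv_cancel, map_one]) hr (by rw [← map_pow, hx, map_one])).resolve_left h3
  refine ⟨_, this, rfl, ?_⟩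
  rw [← pow_mul, mul_comm 2 21, pow_mul, hs]
  linear_combination this

theorem golden_conj {t : ℂ} (ht : t ^ 2 - t - 1 = 0) : (starRingEnd ℂ) t = t := by
  have h2 : ((starRingEnd ℂ) t) ^ 2 - (starRingEnd ℂ) t - 1 = 0 := by
    have := congrArg (starRingEnd ℂ) ht
    simpa using this
  have : ((starRingEnd ℂ) t - t) * ((starRingEnd ℂ) t - (1 - t)) = 0 := by
    linear_combination h2 - ht
  rcases mul_eq_zero.1 this with h | h
  · linear_combination h
  · exfalso
    have h3 : t * (starRingEnd ℂ) t = -1 := by linear_combination t * h - ht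
    rw [Complex.mul_conj] at h3
    have h4 : Complex.normSq t = -1 := by exact_mod_cast h3
    linarith [Complex.normSq_nonneg t]

variable (hzc : Nat.card (Subgroup.center G) = 3)
  (hscal : ∀ z ∈ Subgroup.center G, ∃ c : ℂ, c ^ 3 = 1 ∧ R z = c • 1)
  (hnorm : ∑ g, (R g).trace * (R g⁻¹).trace = 1080)

include hdet in
theorem tr_inv_conj (g : G) : (R g⁻¹).trace = (starRingEnd ℂ) (R g).trace :=
  tr_conj (R g) (R g⁻¹) (hdet g) (Fintype.card G) Fintype.card_ne_zero
    (by rw [← map_pow, pow_card_eq_one, map_one]) (by rw [← map_mul, mul_inv_cancel, map_one])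

include hscal in
theorem tr_mul_center (z : G) (hz : z ∈ Subgroup.center G) :
    ∃ c : ℂ, c ^ 3 = 1 ∧ (starRingEnd ℂ) c = c ^ 2 ∧ (R z).trace = 3 * c ∧
      ∀ g, (R (g * z)).trace = c * (R g).trace := by
  obtain ⟨c, hc, hR⟩ := hscal z hz
  refine ⟨c, hc, ?_, ?_, ?_⟩
  · have := conj_of_pow three_ne_zero hc
    linear_combination c ^ 2 * this - (starRingEnd ℂ) c * hc
  · rw [hR, Matrix.trace_smul, tr_one3, smul_eq_mul, mul_comm]
  · intro g
    rw [map_mul, hR, mul_smul_comm, mul_one, Matrix.trace_smul, smul_eq_mul]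

include hsurj hdet hfaith hker hz3 hzc hscal hnorm in
theorem val3 (g : G) (h : π g ^ 3 = 1) (h' : π g ≠ 1) : (R g).trace = 0 := by
  set H : G → ℂ := fun g => (starRingEnd ℂ) (R g).trace * (R g).trace with hHdef
  have hH : ∀ g, ∀ z ∈ Subgroup.center G, H (g * z) = H g := by
    intro g z hz
    obtain ⟨c, hc, hcc, -, hm⟩ := tr_mul_center R hscal z hz
    simp only [hHdef]
    rw [hm, map_mul, hcc]
    linear_combination ((starRingEnd ℂ) (R g).trace * (R g).trace) * hc
  have hsum := group_sum π hsurj hker hz3 hzc H hH 9 1 1 3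
    (by simp only [hHdef, map_one, tr_one3, conj_three]; norm_num)
    (fun g h h' => by simp only [hHdef]; rw [val2 π hker hz3 R hdet hfaith g h h']; simp)
    (fun g h h' => by simp only [hHdef]; rw [val4 π hsurj hker hz3 R hdet hfaith g h h']; simp)
    (fun g h h' => by
      obtain ⟨t, ht, e1, e2⟩ := val5 π hsurj hker hz3 R hdet hfaith g h h'
      simp only [hHdef, e1, e2, map_sub, map_one, golden_conj ht]
      linear_combination 2 * ht)
  have hH' : ∑ g, H g = 1080 := by
    rw [← hnorm]
    refine Finset.sum_congr rfl fun g _ => ?_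
    rw [tr_inv_conj R hdet, mul_comm]
  rw [hH'] at hsum
  have hs0 : ∑ q ∈ Finset.univ.filter (fun q : A6 => q ^ 3 = 1 ∧ q ≠ 1),
      H (Function.surjInv hsurj q) = 0 := by linear_combination -hsum / 3
  have hHn : ∀ g, H g = ((Complex.normSq (R g).trace : ℝ) : ℂ) := by
    intro g; simp only [hHdef]; rw [mul_comm, Complex.mul_conj]
  simp only [hHn] at hs0
  rw [← Complex.ofReal_sum, Complex.ofReal_eq_zero,
    Finset.sum_eq_zero_iff_of_nonneg (fun _ _ => Complex.normSq_nonneg _)] at hs0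
  have h0 := hs0 (π g) (by simp [h, h'])
  set l := Function.surjInv hsurj (π g) with hl
  have hlπ : π l = π g := Function.surjInv_eq hsurj _
  have hz : l⁻¹ * g ∈ Subgroup.center G := by
    rw [← hker, map_mul, map_inv, hlπ, inv_mul_cancel]
  have : H g = H l := by rw [← hH l _ hz]; congr 1; group
  rw [hHn, hHn, h0] at this
  exact Complex.normSq_eq_zero.1 (by exact_mod_cast this)

include hsurj hdet hfaith hker hz3 hzc hscal hnorm in
/-- The sum formula, for `H` a polynomial expression in the character. -/
theorem poly_sum (P : ℂ → ℂ) (h0 : P 0 = 0)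
    (hP : ∀ g, ∀ z ∈ Subgroup.center G, P (R (g * z)).trace = P (R g).trace)
    (A B C D : ℂ) (h1 : P 3 = A) (h2 : P (-1) = B) (h4 : P 1 = C)
    (h5 : ∀ t : ℂ, t ^ 2 - t - 1 = 0 → P t + P (1 - t) = D) :
    ∑ g, P (R g).trace = 3 * (A + 45 * B + 90 * C + 72 * D) := by
  rw [group_sum π hsurj hker hz3 hzc (fun g => P (R g).trace) hP A B C D
    (by simp only [map_one, tr_one3, h1])
    (fun g h h' => by simp only [val2 π hker hz3 R hdet hfaith g h h', h2])
    (fun g h h' => by simp only [val4 π hsurj hker hz3 R hdet hfaith g h h', h4])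
    (fun g h h' => by
      obtain ⟨t, ht, e1, e2⟩ := val5 π hsurj hker hz3 R hdet hfaith g h h'
      simp only [e1, e2, h5 t ht])]
  rw [Finset.sum_eq_zero, add_zero]
  intro q hq
  simp only [Finset.mem_filter, Finset.mem_univ, true_and] at hq
  have hl := Function.surjInv_eq hsurj q
  rw [val3 π hsurj hker hz3 R hdet hfaith hzc hscal hnorm _ (by rw [hl, hq.1])
    (by rw [hl]; exact hq.2), h0]

include hsurj hdet hfaith hker hz3 hzc hscal hnorm in
theorem core_sums (hInt : ∃ n : ℕ, ∑ g, (R g).trace = 1080 * n) (τ : ℂ ≃+* ℂ)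
    (hτ3 : ∀ c : ℂ, c ^ 3 = 1 → τ c = c ^ 2)
    (hτ5 : ∀ t : ℂ, t ^ 2 - t - 1 = 0 → τ t = 1 - t) :
    (∑ g, (starRingEnd ℂ) (τ (R g).trace * (R g).trace) * (τ (R g).trace * (R g).trace) = 1080) ∧
    (∑ g, (starRingEnd ℂ) (τ (R g).trace) * (R g).trace ^ 5 = 1080) ∧
    (∀ n : ℕ, 1 ≤ n → n ≤ 4 →
      ∑ g, (starRingEnd ℂ) (τ (R g).trace) * (R g).trace ^ n = 0) := by
  have hτt : ∀ t : ℂ, t ^ 2 - t - 1 = 0 → (starRingEnd ℂ) (τ t) = 1 - t := fun t ht => by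
    rw [hτ5 t ht, map_sub, map_one, golden_conj ht]
  have hτt' : ∀ t : ℂ, t ^ 2 - t - 1 = 0 → (starRingEnd ℂ) (τ (1 - t)) = t := fun t ht => by
    rw [map_sub, map_sub, hτt t ht]; simp
  have hmul : ∀ z ∈ Subgroup.center G, ∃ c : ℂ, c ^ 3 = 1 ∧ (starRingEnd ℂ) c = c ^ 2 ∧
      (R z).trace = 3 * c ∧ ∀ g, (R (g * z)).trace = c * (R g).trace ∧
        τ (R (g * z)).trace = c ^ 2 * τ (R g).trace ∧
        (starRingEnd ℂ) (τ (R (g * z)).trace) = c * (starRingEnd ℂ) (τ (R g).trace) := by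
    intro z hz
    obtain ⟨c, hc, hcc, ht, hm⟩ := tr_mul_center R hscal z hz
    refine ⟨c, hc, hcc, ht, fun g => ⟨hm g, by rw [hm, map_mul, hτ3 c hc], ?_⟩⟩
    rw [hm, map_mul, hτ3 c hc, map_mul, map_pow, hcc]
    linear_combination c * (starRingEnd ℂ) (τ (R g).trace) * hc
  have hPS := poly_sum π hsurj hker hz3 R hdet hfaith hzc hscal hnorm
  have hτ3' : τ 3 = 3 := map_ofNat τ 3
  refine ⟨?_, ?_, ?_⟩
  · rw [hPS (fun x => (starRingEnd ℂ) (τ x * x) * (τ x * x)) (by simp) ?_ 81 1 1 2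
      (by simp [hτ3', conj_three]; try norm_num) (by simp) (by simp) ?_]
    · norm_num
    · intro g z hz
      obtain ⟨c, hc, hcc, -, hm⟩ := hmul z hz
      obtain ⟨m1, m2, m3⟩ := hm g
      rw [map_mul, map_mul (starRingEnd ℂ) (τ (R g).trace), m3, m2, m1, map_mul, hcc]
      linear_combination (c ^ 3 + 1) * ((starRingEnd ℂ) (τ (R g).trace) * (starRingEnd ℂ) (R g).trace
        * τ (R g).trace * (R g).trace) * hc
    · intro t ht
      have e : τ t * t = -1 := by rw [hτ5 t ht]; linear_combination -ht
      have e' : τ (1 - t) * (1 - t) = -1 := by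
        rw [map_sub, map_one, hτ5 t ht]; linear_combination -ht
      simp only [e, e']; simp; norm_num
  · rw [hPS (fun x => (starRingEnd ℂ) (τ x) * x ^ 5) (by simp) ?_ 729 1 1 (-7)
      (by simp [hτ3', conj_three]; try norm_num) (by simp; norm_num) (by simp) ?_]
    · norm_num
    · intro g z hz
      obtain ⟨c, hc, hcc, -, hm⟩ := hmul z hz
      obtain ⟨m1, m2, m3⟩ := hm g
      rw [m3, m1]
      linear_combination (c ^ 3 + 1) * ((starRingEnd ℂ) (τ (R g).trace) * (R g).trace ^ 5) * hc
    · intro t ht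
      simp only [hτt t ht, hτt' t ht]
      have e : t ^ 2 = t + 1 := by linear_combination ht
      have e3 : t ^ 3 = 2 * t + 1 := by linear_combination (t + 1) * ht
      have e4 : t ^ 4 = 3 * t + 2 := by linear_combination t * e3 + 2 * e
      have e5 : t ^ 5 = 5 * t + 3 := by linear_combination t * e4 + 3 * e
      have e6 : t ^ 6 = 8 * t + 5 := by linear_combination t * e5 + 5 * e
      ring_nf
      simp only [e, e3, e4, e5, e6]
      ring
  · obtain ⟨z0, hz0, hne⟩ : ∃ z ∈ Subgroup.center G, (R z).trace ≠ 3 := by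
      by_contra! hcon
      obtain ⟨n, hn⟩ := hInt
      rw [hPS (fun x => x) rfl ?_ 3 (-1) 1 1 rfl rfl rfl (fun t _ => by ring)] at hn
      · have : (360 : ℂ) = 1080 * n := by rw [← hn]; norm_num
        have : (360 : ℕ) = 1080 * n := by exact_mod_cast this
        omega
      · intro g z hz
        obtain ⟨c, hc, hcc, ht, hm⟩ := hmul z hz
        have : c = 1 := by linear_combination (hcon z hz - ht) / 3
        simp only [(hm g).1, this, one_mul]
    obtain ⟨c, hc, hcc, ht, hm⟩ := hmul z0 hz0
    have hc1 : c ≠ 1 := fun h => hne (by rw [ht, h, mul_one])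
    have shift : ∀ n : ℕ, c ^ (n + 1) ≠ 1 →
        ∑ g, (starRingEnd ℂ) (τ (R g).trace) * (R g).trace ^ n = 0 := by
      intro n hn
      set S := ∑ g, (starRingEnd ℂ) (τ (R g).trace) * (R g).trace ^ n with hS
      have : S = c ^ (n + 1) * S := by
        conv_lhs => rw [hS, ← Equiv.sum_comp (Equiv.mulRight z0)]
        rw [hS, Finset.mul_sum]
        refine Finset.sum_congr rfl fun g _ => ?_
        rw [Equiv.coe_mulRight, (hm g).2.2, (hm g).1]
        ring
      have h0 : (c ^ (n + 1) - 1) * S = 0 := by linear_combination -this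
      exact (mul_eq_zero.1 h0).resolve_left (sub_ne_zero.2 hn)
    have hc2 : c ^ 2 ≠ 1 := fun h => hc1 (by linear_combination hc - c * h)
    intro n hn hn'
    interval_cases n
    · exact shift 1 hc2
    · rw [hPS (fun x => (starRingEnd ℂ) (τ x) * x ^ 2) (by simp) ?_ 27 (-1) 1 (-1)
        (by simp [hτ3', conj_three]; try norm_num) (by simp) (by simp) ?_]
      · norm_num
      · intro g z hz
        obtain ⟨c, hc, hcc, -, hm⟩ := hmul z hz
        obtain ⟨m1, m2, m3⟩ := hm g
        rw [m3, m1]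
        linear_combination ((starRingEnd ℂ) (τ (R g).trace) * (R g).trace ^ 2) * hc
      · intro t ht
        simp only [hτt t ht, hτt' t ht]
        linear_combination -ht
    · exact shift 3 (fun h => hc1 (by linear_combination h - c * hc))
    · exact shift 4 (fun h => hc2 (by linear_combination h - c ^ 2 * hc))

end core

section final

/-- Twist of a representation on `ℂ³` by a field automorphism. -/
noncomputable def twist {G : Type*} [Group G] (τ : ℂ ≃+* ℂ)
    (ρ : Representation ℂ G (Fin 3 → ℂ)) : Representation ℂ G (Fin 3 → ℂ) where
  toFun g :=
    { toFun := fun v i => τ (ρ g (fun j => τ.symm (v j)) i)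
      map_add' := fun v w => by
        ext i
        have : (fun j => τ.symm ((v + w) j)) = (fun j => τ.symm (v j)) + fun j => τ.symm (w j) := by
          ext j; simp
        change τ (ρ g (fun j => τ.symm ((v + w) j)) i) = _
        rw [this, map_add, Pi.add_apply, map_add]
        rfl
      map_smul' := fun c v => by
        ext i
        have : (fun j => τ.symm ((c • v) j)) = τ.symm c • (fun j => τ.symm (v j)) := by
          ext j; simp
        change τ (ρ g (fun j => τ.symm ((c • v) j)) i) = _
        rw [this, map_smul, Pi.smul_apply, smul_eq_mul, map_mul, RingEquiv.apply_symm_apply]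
        rfl }
  map_one' := by ext; simp
  map_mul' g h := by
    apply LinearMap.ext
    intro v
    ext i
    simp

theorem twist_apply {G : Type*} [Group G] (τ : ℂ ≃+* ℂ) (ρ : Representation ℂ G (Fin 3 → ℂ))
    (g : G) (v : Fin 3 → ℂ) :
    twist τ ρ g v = fun i => τ (ρ g (fun j => τ.symm (v j)) i) := rfl

theorem trace_toMatrix3 (L : (Fin 3 → ℂ) →ₗ[ℂ] (Fin 3 → ℂ)) :
    (LinearMap.toMatrix' L).trace = LinearMap.trace ℂ _ L := by
  rw [← Matrix.trace_toLin'_eq, Matrix.toLin'_toMatrix']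

theorem twist_trace {G : Type*} [Group G] (τ : ℂ ≃+* ℂ) (ρ : Representation ℂ G (Fin 3 → ℂ))
    (g : G) : LinearMap.trace ℂ _ (twist τ ρ g) = τ (LinearMap.trace ℂ _ (ρ g)) := by
  rw [← trace_toMatrix3, ← trace_toMatrix3]
  simp only [Matrix.trace, Matrix.diag, map_sum]
  refine Finset.sum_congr rfl fun i _ => ?_
  rw [LinearMap.toMatrix'_apply, LinearMap.toMatrix'_apply, twist_apply]
  have key : ∀ u w : Fin 3 → ℂ, u = w → τ (ρ g u i) = τ (ρ g w i) := fun u w h => by rw [h]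
  apply key
  ext j
  by_cases h : j = i
  · subst h; simp
  · simp [h]

theorem twist_irr {G : Type*} [Group G] (τ : ℂ ≃+* ℂ) (ρ : Representation ℂ G (Fin 3 → ℂ))
    (h : ∀ p : Submodule ℂ (Fin 3 → ℂ), (∀ g, ∀ v ∈ p, ρ g v ∈ p) → p = ⊥ ∨ p = ⊤)
    (p : Submodule ℂ (Fin 3 → ℂ)) (hp : ∀ g, ∀ v ∈ p, twist τ ρ g v ∈ p) : p = ⊥ ∨ p = ⊤ := by
  let p' : Submodule ℂ (Fin 3 → ℂ) :=
    { carrier := {v | (fun j => τ (v j)) ∈ p}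
      add_mem' := fun {v w} hv hw => by
        have := p.add_mem hv hw
        simp only [Set.mem_ofPred_eq]
        convert this using 1
        ext j; simp
      zero_mem' := by
        simp only [Set.mem_ofPred_eq]
        convert p.zero_mem using 1
        ext j; simp
      smul_mem' := fun c v hv => by
        have := p.smul_mem (τ c) hv
        simp only [Set.mem_ofPred_eq]
        convert this using 1
        ext j; simp }
  have hmem : ∀ v, v ∈ p' ↔ (fun j => τ (v j)) ∈ p := fun v => Iff.rfl
  have hmem' : ∀ v, v ∈ p ↔ (fun j => τ.symm (v j)) ∈ p' := fun v => by
    rw [hmem]; simp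
  rcases h p' (fun g v hv => by
    have := hp g _ ((hmem v).1 hv)
    rw [twist_apply] at this
    rw [hmem]
    simpa using this) with h0 | h0
  · left
    rw [eq_bot_iff]
    intro v hv
    rw [hmem', h0, Submodule.mem_bot] at hv
    rw [Submodule.mem_bot]
    ext j
    simpa using congrFun hv j
  · right
    rw [eq_top_iff]
    intro v _
    rw [hmem', h0]
    trivial

end final

/-- Let `G` be a finite perfect group of order 1080 whose center has order 3,
with `G / Z(G) ≅ A₆` (the triple cover `3.A₆ = Σ(360φ)`), and let `f` be the character of an
irreducible 3-dimensional complex representation of `G`.  Then there exists a character `lam`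
of an irreducible 3-dimensional complex representation of `G` such that `lam·f` is an
irreducible character (`⟨lam·f, lam·f⟩ = 1`), `⟨lam, f⁵⟩ = 1`, and `⟨lam, f^n⟩ = 0` for
`1 ≤ n ≤ 4`. -/
theorem sigma360phi_exists_code_irrep
    {G : Type*} [Group G] [Fintype G]
    (hperfect : commutator G = ⊤)
    (hcard : Nat.card G = 1080)
    (hcenter : Nat.card (Subgroup.center G) = 3)
    (hquot : Nonempty ((G ⧸ Subgroup.center G) ≃* alternatingGroup (Fin 6)))
    (ρf : Representation ℂ G (Fin 3 → ℂ))
    (hfirr : ∀ p : Submodule ℂ (Fin 3 → ℂ),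
      (∀ g, ∀ v ∈ p, ρf g v ∈ p) → p = ⊥ ∨ p = ⊤)
    (f : G → ℂ)
    (hf : ∀ g, f g = LinearMap.trace ℂ (Fin 3 → ℂ) (ρf g)) :
    ∃ ρl : Representation ℂ G (Fin 3 → ℂ),
      (∀ p : Submodule ℂ (Fin 3 → ℂ), (∀ g, ∀ v ∈ p, ρl g v ∈ p) → p = ⊥ ∨ p = ⊤) ∧
      ∃ lam : G → ℂ, (∀ g, lam g = LinearMap.trace ℂ (Fin 3 → ℂ) (ρl g)) ∧
        innerChar _ (fun g => lam g * f g) (fun g => lam g * f g) = 1 ∧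
        innerChar _ lam (fun g => f g ^ 5) = 1 ∧
        ∀ n : ℕ, 1 ≤ n → n ≤ 4 → innerChar _ lam (fun g => f g ^ n) = 0 := by
  classical
  obtain ⟨φ⟩ := hquot
  obtain ⟨τ, hτ3, hτ5⟩ := exists_tau
  -- the projection to `A₆`
  let π : G →* A6 := φ.toMonoidHom.comp (QuotientGroup.mk' (Subgroup.center G))
  have hsurj : Function.Surjective π := φ.surjective.comp (QuotientGroup.mk'_surjective _)
  have hker : ∀ g, π g = 1 ↔ g ∈ Subgroup.center G := by
    intro g
    change φ (QuotientGroup.mk' (Subgroup.center G) g) = 1 ↔ _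
    rw [map_eq_one_iff φ φ.injective, ← MonoidHom.mem_ker, QuotientGroup.ker_mk']
  have hz3 : ∀ z ∈ Subgroup.center G, z ^ 3 = 1 := by
    intro z hz
    have h : (⟨z, hz⟩ : Subgroup.center G) ^ Nat.card (Subgroup.center G) = 1 := pow_card_eq_one'
    rw [hcenter] at h
    simpa using congrArg Subtype.val h
  -- the matrix representation
  let R : G →* M3 := (LinearMap.toMatrixAlgEquiv' (R := ℂ) (n := Fin 3) :
    ((Fin 3 → ℂ) →ₗ[ℂ] (Fin 3 → ℂ)) →* M3).comp ρf
  have hRdef : ∀ g, R g = LinearMap.toMatrix' (ρf g) := fun g => rfl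
  have hRtr : ∀ g, (R g).trace = f g := by
    intro g
    rw [hf, hRdef]; exact trace_toMatrix3 _
  have hR1 : ∀ g, R g = 1 → ρf g = 1 := by
    intro g h
    rw [hRdef, ← LinearMap.toMatrix'_one] at h
    exact LinearMap.toMatrix'.injective h
  have hdet : ∀ g, (R g).det = 1 := by
    intro g
    let d : G →* ℂˣ := ((Matrix.detMonoidHom : M3 →* ℂ).comp R).toHomUnits
    have h1 : g ∈ d.ker := by
      apply Abelianization.commutator_subset_ker d
      rw [hperfect]; trivial
    rw [MonoidHom.mem_ker] at h1
    simpa [d] using congrArg Units.val h1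
  -- irreducibility
  have hnt : ¬ ∀ g, ρf g = 1 := by
    intro h
    have h2 := hfirr (Submodule.span ℂ {Pi.single 0 1}) (fun g v hv => by rw [h g]; exact hv)
    rcases h2 with h2 | h2
    · rw [Submodule.span_singleton_eq_bot] at h2
      simpa using congrFun h2 0
    · have : (Pi.single 1 1 : Fin 3 → ℂ) ∈ Submodule.span ℂ {(Pi.single 0 1 : Fin 3 → ℂ)} := by
        rw [h2]; trivial
      rw [Submodule.mem_span_singleton] at this
      obtain ⟨a, ha⟩ := this
      simpa using congrFun ha 1
  have hscal : ∀ z ∈ Subgroup.center G, ∃ c : ℂ, c ^ 3 = 1 ∧ R z = c • 1 := by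
    intro z hz
    obtain ⟨c, hc⟩ := Module.End.exists_eigenvalue (ρf z)
    have h2 := hfirr (Module.End.eigenspace (ρf z) c) (fun g v hv => by
      rw [Module.End.mem_eigenspace_iff] at hv ⊢
      have := Subgroup.mem_center_iff.1 hz g
      rw [← Module.End.mul_apply, ← map_mul, ← this, map_mul, Module.End.mul_apply, hv, map_smul])
    have h3 := h2.resolve_left hc
    have h4 : R z = c • 1 := by
      rw [hRdef, ← LinearMap.toMatrix'_one, ← map_smul]
      congr 1
      apply LinearMap.ext
      intro v
      have : v ∈ Module.End.eigenspace (ρf z) c := by rw [h3]; trivial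
      rw [Module.End.mem_eigenspace_iff] at this
      rw [this]; rfl
    refine ⟨c, ?_, h4⟩
    have := hdet z
    rw [h4, Matrix.det_smul] at this
    simpa using this
  have hfaith : ∀ g, R g = 1 → π g = 1 := by
    by_contra! hcon
    obtain ⟨g, hg, hπg⟩ := hcon
    have hs : IsSimpleGroup A6 := alternatingGroup.isSimpleGroup (by simp)
    have hn : (R.ker.map π).Normal := Subgroup.Normal.map inferInstance π hsurj
    rcases hn.eq_bot_or_eq_top with h | h
    · apply hπg
      have : π g ∈ R.ker.map π := ⟨g, hg, rfl⟩
      rwa [h, Subgroup.mem_bot] at this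
    · have hcs : ∀ x, ∃ c : ℂ, R x = c • 1 := by
        intro x
        have hx : π x ∈ R.ker.map π := by rw [h]; trivial
        obtain ⟨k, hk, hkx⟩ := hx
        have hz : k⁻¹ * x ∈ Subgroup.center G := by
          rw [← hker, map_mul, map_inv, hkx, inv_mul_cancel]
        obtain ⟨c, -, hc⟩ := hscal _ hz
        refine ⟨c, ?_⟩
        have hk2 : R k⁻¹ = 1 := R.ker.inv_mem hk
        rw [← hc, map_mul, hk2, one_mul]
      have hcomm : commutator G ≤ R.ker := by
        rw [commutator_def, Subgroup.commutator_le]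
        intro a _ b _
        rw [MonoidHom.mem_ker, commutatorElement_def]
        obtain ⟨c, hc⟩ := hcs a
        have : R (a * b) = R (b * a) := by rw [map_mul, map_mul, hc]; simp
        rw [show a * b * a⁻¹ * b⁻¹ = (a * b) * (b * a)⁻¹ by group, map_mul, this, ← map_mul,
          mul_inv_cancel, map_one]
      rw [hperfect] at hcomm
      exact hnt fun x => hR1 x (hcomm (Subgroup.mem_top x))
  have hcardC : (Nat.card G : ℂ) = 1080 := by rw [hcard]; norm_num
  have hinv : Invertible (Nat.card G : ℂ) := invertibleOfNonzero (by rw [hcardC]; norm_num)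
  have hirr : Representation.IsIrreducible ρf := by
    have : Nontrivial (Subrepresentation ρf) := by
      refine ⟨⊥, ⊤, fun h => ?_⟩
      have := congrArg Subrepresentation.toSubmodule h
      exact bot_ne_top (α := Submodule ℂ (Fin 3 → ℂ)) this
    refine ⟨fun a => ?_⟩
    rcases hfirr a.toSubmodule (fun g v hv => a.apply_mem_toSubmodule g hv) with h | h
    · exact Or.inl (Subrepresentation.toSubmodule_injective h)
    · exact Or.inr (Subrepresentation.toSubmodule_injective h)
  have hchar : ∀ g, ρf.character g = (R g).trace := fun g => by rw [hRtr, hf]; rfl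
  have hnorm : ∑ g, (R g).trace * (R g⁻¹).trace = 1080 := by
    have h := Representation.char_orthonormal ρf ρf
    rw [if_pos ⟨Representation.Equiv.refl ρf⟩, hcardC] at h
    simp only [hchar] at h
    have h2 : (1080 : ℂ) ≠ 0 := by norm_num
    field_simp at h
    simpa using h
  have hInt : ∃ n : ℕ, ∑ g, (R g).trace = 1080 * n := by
    have h := Representation.card_inv_mul_sum_char_eq_finrank ρf
    rw [hcardC] at h
    simp only [hchar] at h
    refine ⟨Module.finrank ℂ ρf.invariants, ?_⟩
    rw [← h]; field_simp
  obtain ⟨c1, c2, c3⟩ := core_sums π hsurj hker hz3 R hdet hfaith hcenter hscal hnorm hInt τ hτ3 hτ5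
  have hcF : (Fintype.card G : ℂ) = 1080 := by rw [← Nat.card_eq_fintype_card, hcardC]
  simp only [hRtr] at c1 c2 c3
  refine ⟨twist τ ρf, twist_irr τ ρf hfirr, fun g => τ (f g), fun g => ?_, ?_, ?_, ?_⟩
  · change τ (f g) = _
    rw [twist_trace, hf]
  · rw [innerChar, hcF, c1]; norm_num
  · rw [innerChar, hcF, c2]; norm_num
  · intro n h1 h4
    rw [innerChar, hcF, c3 n h1 h4, mul_zero]
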